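/- Let T be a subcubic tree and let Z be a subset of the vertices of T all of which have degree at most 2 in T. Then T contains at least ⌊|Z|/2⌋ pairwise vertex-disjoint Z-paths. -/

import Mathlib

open Finset

/-- If a vertex `v` lies on geodesics `a b` and `c d` and the pairing `ab, cd` cannot be
improved, then `v` has too large a degree. -/
lemma exchange_aux {V : Type*} [Fintype V] [DecidableEq V]
    (T : SimpleGraph V) [DecidableRel T.Adj] (hc : T.Connected)
    (hSub : ∀ v : V, T.degree v ≤ 3) (a b c d v : V)
    (hab : a ≠ b) (hac : a ≠ c) (had : a ≠ d) (hbc : b ≠ c) (hbd : b ≠ d) (hcd : c ≠ d)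
    (ha : T.degree a ≤ 2) (hb : T.degree b ≤ 2) (hc' : T.degree c ≤ 2) (hd : T.degree d ≤ 2)
    (h1 : T.dist v a + T.dist v b = T.dist a b)
    (h2 : T.dist v c + T.dist v d = T.dist c d)
    (m1 : T.dist a b + T.dist c d ≤ T.dist a c + T.dist b d)
    (m2 : T.dist a b + T.dist c d ≤ T.dist a d + T.dist b c) : False := by
  have hn : ∀ x, ∃ y, x ≠ v → T.Adj v y ∧ T.dist y x + 1 = T.dist v x := by
    intro x
    by_cases hx : x = v
    · exact ⟨v, fun h => absurd hx h⟩
    obtain ⟨w, hw⟩ := (hc v x).exists_walk_length_eq_dist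
    cases w with
    | nil => exact absurd rfl hx
    | @cons _ y _ h p =>
      refine ⟨y, fun _ => ⟨h, ?_⟩⟩
      have e1 := T.dist_le p
      have e2 := hc.dist_triangle (u := v) (v := y) (w := x)
      have e3 : T.dist v y = 1 := SimpleGraph.dist_eq_one_iff_adj.2 h
      simp only [SimpleGraph.Walk.length_cons] at hw
      omega
  choose n hn using hn
  have key : ∀ x y, x ≠ v → y ≠ v → n x = n y → T.dist x y + 2 ≤ T.dist v x + T.dist v y := by
    intro x y hx hy h
    have e1 := (hn x hx).2
    have e2 := (hn y hy).2
    have e3 := hc.dist_triangle (u := x) (v := n x) (w := y)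
    rw [T.dist_comm (u := x) (v := n x)] at e3
    rw [h] at e1 e3
    omega
  have tri : ∀ x y, T.dist x y ≤ T.dist v x + T.dist v y := by
    intro x y
    have e3 := hc.dist_triangle (u := x) (v := v) (w := y)
    rwa [T.dist_comm (u := x) (v := v)] at e3
  have inj : Set.InjOn n ((({a, b, c, d} : Finset V).erase v : Finset V) : Set V) := by
    intro x hx y hy hxy
    by_contra hne
    simp only [coe_erase, coe_insert, coe_singleton, Set.mem_sdiff, Set.mem_insert_iff,
      Set.mem_singleton_iff] at hx hy
    have k := key x y hx.2 hy.2 hxy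
    have t1 := tri a c
    have t2 := tri b d
    have t3 := tri a d
    have t4 := tri b c
    have s1 := T.dist_comm (u := a) (v := b)
    have s2 := T.dist_comm (u := a) (v := c)
    have s3 := T.dist_comm (u := a) (v := d)
    have s4 := T.dist_comm (u := b) (v := c)
    have s5 := T.dist_comm (u := b) (v := d)
    have s6 := T.dist_comm (u := c) (v := d)
    rcases hx.1 with rfl | rfl | rfl | rfl <;> rcases hy.1 with rfl | rfl | rfl | rfl <;>
      first | exact hne rfl | omega
  have hle : (({a, b, c, d} : Finset V).erase v).card ≤ T.degree v := by
    rw [← T.card_neighborFinset_eq_degree]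
    refine card_le_card_of_injOn n ?_ inj
    intro x hx
    have hx' : x ≠ v := (mem_erase.1 hx).1
    simpa using (hn x hx').1
  have h4 : ({a, b, c, d} : Finset V).card = 4 := by
    rw [card_insert_of_notMem, card_insert_of_notMem, card_pair hcd] <;> simp [*]
  by_cases hv : v ∈ ({a, b, c, d} : Finset V)
  · rw [card_erase_of_mem hv, h4] at hle
    simp only [mem_insert, mem_singleton] at hv
    rcases hv with rfl | rfl | rfl | rfl <;> omega
  · rw [erase_eq_of_notMem hv, h4] at hle
    have := hSub v
    omega

/-- Let `T` be a subcubic tree and `Z` a set of vertices of `T`, each of degree at most 2.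
Then `T` contains at least `⌊|Z|/2⌋` pairwise vertex-disjoint `Z`-paths. -/
theorem stmt_2 {V : Type*} [Fintype V] [DecidableEq V]
    (T : SimpleGraph V) [DecidableRel T.Adj]
    (hTree : T.IsTree)
    (hSubcubic : ∀ v : V, T.degree v ≤ 3)
    (Z : Finset V)
    (hZ : ∀ v ∈ Z, T.degree v ≤ 2) :
    ∃ P : Fin (Z.card / 2) → Σ u : V, Σ v : V, T.Walk u v,
      (∀ i, (P i).2.2.IsPath ∧ (P i).1 ∈ Z ∧ (P i).2.1 ∈ Z ∧ 1 ≤ (P i).2.2.length) ∧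
      (∀ i j, i ≠ j → List.Disjoint (P i).2.2.support (P j).2.2.support) := by
  have hc : T.Connected := hTree.1
  obtain ⟨h⟩ : Nonempty (Fin (Z.card / 2) × Bool ↪ Z) := by
    apply Function.Embedding.nonempty_of_card_le
    simp
    omega
  obtain ⟨e, he⟩ := Finite.exists_min (fun e : Equiv.Perm (Fin (Z.card / 2) × Bool) =>
    ∑ k, T.dist (h (e (k, false)) : V) (h (e (k, true)) : V))
  set f : Fin (Z.card / 2) × Bool → V := fun p => (h (e p) : V) with hf
  have finj : Function.Injective f := fun p q hpq =>
    e.injective (h.injective (Subtype.ext hpq))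
  have fZ : ∀ p, f p ∈ Z := fun p => (h (e p)).2
  have hmin : ∀ i j, i ≠ j → ∀ s : Equiv.Perm (Fin (Z.card / 2) × Bool),
      (∀ k, k ≠ i → k ≠ j → ∀ t, s (k, t) = (k, t)) →
      T.dist (f (i, false)) (f (i, true)) + T.dist (f (j, false)) (f (j, true)) ≤
      T.dist (f (s (i, false))) (f (s (i, true))) +
        T.dist (f (s (j, false))) (f (s (j, true))) := by
    intro i j hij s hs
    have h0 : ∑ k, T.dist (f (k, false)) (f (k, true)) ≤
      ∑ k, T.dist (f (s (k, false))) (f (s (k, true))) := he (s.trans e)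
    have hj : j ∈ (univ : Finset (Fin (Z.card / 2))).erase i := by simp [hij.symm]
    rw [← add_sum_erase _ _ (mem_univ i), ← add_sum_erase _ _ hj,
      ← add_sum_erase _ (fun k => T.dist (f (s (k, false))) (f (s (k, true)))) (mem_univ i),
      ← add_sum_erase _ (fun k => T.dist (f (s (k, false))) (f (s (k, true)))) hj] at h0
    have : ∑ k ∈ ((univ : Finset (Fin (Z.card / 2))).erase i).erase j,
        T.dist (f (s (k, false))) (f (s (k, true))) =
        ∑ k ∈ ((univ : Finset (Fin (Z.card / 2))).erase i).erase j,
        T.dist (f (k, false)) (f (k, true)) := by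
      refine sum_congr rfl fun k hk => ?_
      simp only [mem_erase] at hk
      rw [hs k hk.2.1 hk.1, hs k hk.2.1 hk.1]
    omega
  have hw : ∀ k, ∃ w : T.Walk (f (k, false)) (f (k, true)), w.IsPath ∧
      w.length = T.dist (f (k, false)) (f (k, true)) := fun k =>
    hc.exists_path_of_dist _ _
  choose w hwp hwl using hw
  have geo : ∀ k v, v ∈ (w k).support →
      T.dist v (f (k, false)) + T.dist v (f (k, true)) =
        T.dist (f (k, false)) (f (k, true)) := by
    intro k v hv
    have e1 := T.dist_le ((w k).takeUntil v hv)
    have e2 := T.dist_le ((w k).dropUntil v hv)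
    have e3 := congrArg SimpleGraph.Walk.length ((w k).take_spec hv)
    rw [SimpleGraph.Walk.length_append, hwl] at e3
    have e4 := hc.dist_triangle (u := f (k, false)) (v := v) (w := f (k, true))
    rw [T.dist_comm (u := f (k, false)) (v := v)] at e1 e4
    omega
  refine ⟨fun k => ⟨_, _, w k⟩, fun k => ⟨hwp k, fZ _, fZ _, ?_⟩, ?_⟩
  · show 1 ≤ (w k).length
    rw [hwl]
    apply hc.pos_dist_of_ne
    intro hh
    simpa using finj hh
  · intro i j hij v hvi hvj
    have m1 := hmin i j hij (Equiv.swap (i, true) (j, false)) (by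
      intro k hki hkj t
      apply Equiv.swap_apply_of_ne_of_ne <;> simp [hki, hkj])
    have m2 := hmin i j hij (Equiv.swap (i, true) (j, true)) (by
      intro k hki hkj t
      apply Equiv.swap_apply_of_ne_of_ne <;> simp [hki, hkj])
    simp only [Equiv.swap_apply_left, Equiv.swap_apply_right] at m1 m2
    rw [Equiv.swap_apply_of_ne_of_ne (x := (i, false)) (by simp) (by simp [hij]),
      Equiv.swap_apply_of_ne_of_ne (x := (j, true)) (by simp [hij.symm]) (by simp)] at m1
    rw [Equiv.swap_apply_of_ne_of_ne (x := (i, false)) (by simp) (by simp),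
      Equiv.swap_apply_of_ne_of_ne (x := (j, false)) (by simp) (by simp)] at m2
    rw [T.dist_comm (u := f (j, false)) (v := f (i, true))] at m2
    refine exchange_aux T hc hSubcubic (f (i, false)) (f (i, true)) (f (j, false)) (f (j, true)) v
      ?_ ?_ ?_ ?_ ?_ ?_ (hZ _ (fZ _)) (hZ _ (fZ _)) (hZ _ (fZ _)) (hZ _ (fZ _))
      (geo i v hvi) (geo j v hvj) m1 m2 <;>
    · apply finj.ne
      simp [hij]
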